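/- Let R be an integral domain. Then R is a PvMD if and only if for all torsion-free R-modules M and N and every maximal w-ideal 𝔪 of R (which is prime), the localization (M ⊗_R N)_𝔪 ≅ M_𝔪 ⊗_{R_𝔪} N_𝔪 is a torsion-free module over the local ring R_𝔪. -/

import Mathlib

open TensorProduct

/-- A finitely generated ideal `J` is a GV-ideal if the natural map
`R → Hom_R(J, R)`, sending `r` to multiplication by `r`, is bijective. -/
def IsGVIdeal {R : Type*} [CommRing R] (J : Ideal R) : Prop :=
  J.FG ∧ Function.Bijective fun r : R => (r • J.subtype : J →ₗ[R] R)

/-- An ideal `I` of `R` is a `w`-ideal if `x ∈ I` whenever `Jx ⊆ I`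
for some GV-ideal `J`. -/
def IsWIdeal {R : Type*} [CommRing R] (I : Ideal R) : Prop :=
  ∀ (J : Ideal R) (x : R), IsGVIdeal J → (∀ j ∈ J, j * x ∈ I) → x ∈ I

/-- A maximal `w`-ideal is an ideal maximal among proper `w`-ideals of `R`. -/
def IsMaximalWIdeal {R : Type*} [CommRing R] (I : Ideal R) : Prop :=
  I ≠ ⊤ ∧ IsWIdeal I ∧ ∀ I' : Ideal R, IsWIdeal I' → I' ≠ ⊤ → I ≤ I' → I' = I

/-- `R` is a PvMD if for every nonzero finitely generated ideal `I` of `R` there is a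
GV-ideal `J` with `J ⊆ I·I⁻¹` (inside the quotient field `K`). -/
def IsPvMD (R : Type*) [CommRing R] [IsDomain R] (K : Type*) [Field K] [Algebra R K]
    [IsFractionRing R K] : Prop :=
  ∀ I : Ideal R, I ≠ ⊥ → I.FG →
    ∃ J : Ideal R, IsGVIdeal J ∧
      (J : FractionalIdeal (nonZeroDivisors R) K) ≤
        (I : FractionalIdeal (nonZeroDivisors R) K) *
          (I : FractionalIdeal (nonZeroDivisors R) K)⁻¹

section GVIdeal

variable {R : Type*} [CommRing R]

theorem IsGVIdeal.top : IsGVIdeal (⊤ : Ideal R) := by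
  refine ⟨Module.Finite.fg_top, fun r s h => ?_, fun f => ⟨f ⟨1, trivial⟩, ?_⟩⟩
  · simpa using LinearMap.congr_fun h ⟨1, trivial⟩
  · ext ⟨x, hx⟩
    have : (⟨x, hx⟩ : (⊤ : Ideal R)) = x • ⟨1, trivial⟩ := by ext; simp
    rw [this, map_smul]
    simp [mul_comm]

theorem IsGVIdeal.mul {J J' : Ideal R} (hJ : IsGVIdeal J) (hJ' : IsGVIdeal J') :
    IsGVIdeal (J * J') := by
  refine ⟨hJ.1.mul hJ'.1, fun r s h => hJ.2.1 ?_, fun f => ?_⟩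
  · ext j
    refine hJ'.2.1 (LinearMap.ext fun x => ?_)
    have := LinearMap.congr_fun h ⟨j * x, Ideal.mul_mem_mul j.2 x.2⟩
    simpa [mul_assoc] using this
  · let e : R ≃ₗ[R] (J' →ₗ[R] R) := LinearEquiv.ofBijective
      { toFun := fun r => r • J'.subtype
        map_add' := fun r s => add_smul _ _ _
        map_smul' := fun r s => by simp [mul_smul] } hJ'.2
    let g : J →ₗ[R] J' →ₗ[R] R := LinearMap.mk₂ R
      (fun j x => f ⟨j * x, Ideal.mul_mem_mul j.2 x.2⟩)
      (fun j₁ j₂ x => by rw [← map_add]; congr 1; ext; simp [add_mul])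
      (fun c j x => by rw [← map_smul]; congr 1; ext; simp [mul_assoc])
      (fun j x₁ x₂ => by rw [← map_add]; congr 1; ext; simp [mul_add])
      (fun c j x => by rw [← map_smul]; congr 1; ext; simp [mul_left_comm])
    obtain ⟨r, hr⟩ := hJ.2.2 (e.symm.toLinearMap ∘ₗ g)
    have key (j : J) (x : J') : f ⟨j * x, Ideal.mul_mem_mul j.2 x.2⟩ = r * (j * x) := by
      have h₁ : e (r * j) = g j := by
        rw [← e.apply_symm_apply (g j)]
        exact congrArg e (LinearMap.congr_fun hr j)
      rw [← mul_assoc]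
      exact (LinearMap.congr_fun h₁ x).symm
    refine ⟨r, LinearMap.ext fun ⟨y, hy⟩ => ?_⟩
    change r * y = f ⟨y, hy⟩
    induction hy using Submodule.mul_induction_on' with
    | mem_mul_mem j hj x hx => exact (key ⟨j, hj⟩ ⟨x, hx⟩).symm
    | add x hx y hy h₁ h₂ =>
      rw [mul_add, h₁, h₂, ← map_add]
      rfl

theorem IsWIdeal.not_le {I J : Ideal R} (hI : IsWIdeal I) (hI' : I ≠ ⊤) (hJ : IsGVIdeal J) :
    ¬ J ≤ I := fun h =>
  hI' <| (Ideal.eq_top_iff_one I).2 <| hI J 1 hJ fun j hj => by simpa using h hj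

/-- An ideal containing no GV-ideal lies in a prime maximal `w`-ideal. -/
theorem exists_le_isMaximalWIdeal {A : Ideal R} (hA : ∀ J, IsGVIdeal J → ¬ J ≤ A) :
    ∃ P : Ideal R, A ≤ P ∧ IsMaximalWIdeal P ∧ P.IsPrime := by
  obtain ⟨P, hAP, hP⟩ := zorn_le_nonempty₀ {P : Ideal R | ∀ J, IsGVIdeal J → ¬ J ≤ P}
    (fun c hc hch y hy => by
      refine ⟨sSup c, fun J hJ hJc => ?_, fun z hz => le_sSup hz⟩
      obtain ⟨Q, hQ, hJQ⟩ := (CompleteLattice.isCompactElement_iff_le_of_directed_sSup_le _ J).1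
        ((Submodule.fg_iff_compact J).1 hJ.1) c ⟨y, hy⟩ hch.directedOn hJc
      exact hc hQ J hJ hJQ) A hA
  have hsup (x : R) (hx : x ∉ P) : ∃ J, IsGVIdeal J ∧ J ≤ P ⊔ Ideal.span {x} := by
    by_contra! h
    exact hx (hP.2 h le_sup_left (Ideal.mem_sup_right (Ideal.mem_span_singleton_self x)))
  have hne : P ≠ ⊤ := fun h => hP.1 ⊤ .top h.ge
  refine ⟨P, hAP, ⟨hne, fun J x hJ hx => ?_, fun I hI hI' hPI => ?_⟩, hne, fun {x y} hxy => ?_⟩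
  · by_contra hxP
    obtain ⟨J', hJ', hle⟩ := hsup x hxP
    refine hP.1 _ (hJ.mul hJ') ((Ideal.mul_mono_right hle).trans ?_)
    rw [Ideal.mul_sup, sup_le_iff]
    refine ⟨Ideal.mul_le_right, Ideal.mul_le.2 fun j hj z hz => ?_⟩
    obtain ⟨d, rfl⟩ := Ideal.mem_span_singleton'.1 hz
    rw [mul_left_comm]
    exact P.mul_mem_left _ (hx j hj)
  · exact le_antisymm (hP.2 (fun J hJ => hI.not_le hI' hJ) hPI) hPI
  · by_contra! h
    obtain ⟨J, hJ, hJx⟩ := hsup x h.1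
    obtain ⟨J', hJ', hJy⟩ := hsup y h.2
    refine hP.1 _ (hJ.mul hJ') ((Ideal.mul_mono hJx hJy).trans ?_)
    rw [Ideal.sup_mul, Ideal.mul_sup (Ideal.span {x}), Ideal.span_singleton_mul_span_singleton]
    refine sup_le Ideal.mul_le_left (sup_le Ideal.mul_le_right ?_)
    exact (Ideal.span_singleton_le_iff_mem _).2 hxy

end GVIdeal

section LocallyValuation

/-- A finitely generated ideal is locally principal at `𝔪`
if any two elements are comparable under divisibility at `𝔪`. -/
theorem Ideal.FG.exists_smul_dvd {R : Type*} [CommRing R] {𝔪 : Ideal R} [h𝔪 : 𝔪.IsPrime]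
    (hV : ∀ a b : R, ∃ u ∉ 𝔪, a ∣ u * b ∨ b ∣ u * a) {I : Ideal R} (hI : I.FG) :
    ∃ a ∈ I, ∃ u ∉ 𝔪, ∀ x ∈ I, a ∣ u * x := by
  refine Submodule.fg_induction
    (motive := fun I _ => ∃ a ∈ I, ∃ u ∉ 𝔪, ∀ x ∈ I, a ∣ u * x) (fun a => ?_) ?_ I hI
  · refine ⟨a, Ideal.mem_span_singleton_self a, 1, 𝔪.one_notMem, fun x hx => ?_⟩
    rw [one_mul]
    exact Ideal.mem_span_singleton.1 hx
  · rintro I₁ I₂ - - ⟨a, ha, u, hu, hau⟩ ⟨b, hb, v, hv, hbv⟩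
    obtain ⟨w, hw, h⟩ := hV a b
    have hn : w * u * v ∉ 𝔪 := h𝔪.mul_notMem (h𝔪.mul_notMem hw hu) hv
    rcases h with h | h
    · refine ⟨a, Submodule.mem_sup_left ha, _, hn, fun x hx => ?_⟩
      obtain ⟨y, hy, z, hz, rfl⟩ := Submodule.mem_sup.1 hx
      obtain ⟨c, hc⟩ := hau y hy
      obtain ⟨d, hd⟩ := hbv z hz
      obtain ⟨e, he⟩ := h
      exact ⟨w * v * c + u * e * d, by linear_combination w * v * hc + w * u * hd + u * d * he⟩
    · refine ⟨b, Submodule.mem_sup_right hb, _, hn, fun x hx => ?_⟩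
      obtain ⟨y, hy, z, hz, rfl⟩ := Submodule.mem_sup.1 hx
      obtain ⟨c, hc⟩ := hau y hy
      obtain ⟨d, hd⟩ := hbv z hz
      obtain ⟨e, he⟩ := h
      exact ⟨w * u * d + v * e * c, by linear_combination w * v * hc + w * u * hd + v * c * he⟩

theorem valuationRing_localization_of_dvd {R : Type*} [CommRing R] [IsDomain R]
    {𝔪 : Ideal R} [𝔪.IsPrime] (hV : ∀ a b : R, ∃ u ∉ 𝔪, a ∣ u * b ∨ b ∣ u * a) :
    ValuationRing (Localization 𝔪.primeCompl) := by
  refine ValuationRing.iff_dvd_total.2 ⟨fun x y => ?_⟩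
  obtain ⟨a, s, rfl⟩ := IsLocalization.exists_mk'_eq 𝔪.primeCompl x
  obtain ⟨b, t, rfl⟩ := IsLocalization.exists_mk'_eq 𝔪.primeCompl y
  have aux (c d : R) (p q : 𝔪.primeCompl) (u : R) (hu : u ∉ 𝔪) (h : c ∣ u * d) :
      IsLocalization.mk' (Localization 𝔪.primeCompl) c p ∣ IsLocalization.mk' _ d q := by
    obtain ⟨e, he⟩ := h
    refine ⟨IsLocalization.mk' _ (p * e) (q * ⟨u, hu⟩), ?_⟩
    rw [← IsLocalization.mk'_mul, IsLocalization.mk'_eq_iff_eq]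
    congr 1
    simp only [Submonoid.coe_mul]
    linear_combination (p * q : R) * he
  obtain ⟨u, hu, h | h⟩ := hV a b
  · exact .inl (aux _ _ _ _ u hu h)
  · exact .inr (aux _ _ _ _ u hu h)

theorem flat_localizedModule_of_torsionFree {R : Type*} [CommRing R] [IsDomain R]
    (S : Submonoid R) [IsDomain (Localization S)] [ValuationRing (Localization S)]
    (L : Type*) [AddCommGroup L] [Module R L] [Module.IsTorsionFree R L] :
    Module.Flat R (LocalizedModule S L) := by
  have : Module.Flat (Localization S) (LocalizedModule S L) := by
    rw [Module.Flat.flat_iff_torsion_eq_bot_of_isBezout,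
      ← Submodule.isTorsionFree_iff_torsion_eq_bot]
    infer_instance
  have : Module.Flat R (Localization S) := IsLocalization.flat _ S
  exact Module.Flat.trans R (Localization S) _

theorem tensor_localizedModule_torsionFree {R : Type*} [CommRing R] [IsDomain R]
    (S : Submonoid R) [IsDomain (Localization S)]
    [ValuationRing (Localization S)]
    {M N : Type*} [AddCommGroup M] [Module R M] [AddCommGroup N] [Module R N]
    [Module.IsTorsionFree R M] [Module.IsTorsionFree R N]
    (r : Localization S) (x : LocalizedModule S (M ⊗[R] N)) (h : r • x = 0) :
    r = 0 ∨ x = 0 := by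
  have := flat_localizedModule_of_torsionFree S M
  have := flat_localizedModule_of_torsionFree S N
  let e := IsLocalizedModule.linearEquiv S (LocalizedModule.mkLinearMap S (M ⊗[R] N))
    (TensorProduct.map (LocalizedModule.mkLinearMap S M) (LocalizedModule.mkLinearMap S N))
  obtain ⟨a, s, rfl⟩ := IsLocalization.exists_mk'_eq S r
  have ha : a • x = 0 := by
    rw [← algebraMap_smul (Localization S) a x,
      ← IsLocalization.mk'_spec (Localization S) a s, mul_comm, mul_smul, h, smul_zero]
  have ha' : a • e x = 0 := by rw [← map_smul, ha, map_zero]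
  rcases smul_eq_zero.1 ha' with rfl | hx
  · exact .inl (IsLocalization.mk'_zero _)
  · exact .inr (e.map_eq_zero_iff.1 hx)

/-- If `span {a, b} ⊗ span {a, b}` is torsion-free at `𝔪`, then `a` and `b` are comparable
under divisibility at `𝔪`. -/
theorem exists_dvd_of_tensor_torsionFree {R : Type*} [CommRing R] [IsDomain R]
    {𝔪 : Ideal R} [h𝔪 : 𝔪.IsPrime] {a b : R} (ha : a ≠ 0) (hb : b ≠ 0)
    (H : ∀ (r : Localization 𝔪.primeCompl) (x : LocalizedModule 𝔪.primeCompl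
      (Ideal.span {a, b} ⊗[R] Ideal.span {a, b})), r • x = 0 → r = 0 ∨ x = 0) :
    ∃ u ∉ 𝔪, a ∣ u * b ∨ b ∣ u * a := by
  by_contra! hV
  let a' : Ideal.span {a, b} := ⟨a, Ideal.subset_span (by simp)⟩
  let b' : Ideal.span {a, b} := ⟨b, Ideal.subset_span (by simp)⟩
  let f : R × R →ₗ[R] Ideal.span {a, b} :=
    (LinearMap.toSpanSingleton R _ a').coprod (LinearMap.toSpanSingleton R _ b')
  have hf : Function.Surjective f := fun ⟨x, hx⟩ => by
    obtain ⟨u, v, rfl⟩ := Ideal.mem_span_pair.1 hx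
    exact ⟨(u, v), Subtype.ext (by simp [f, a', b'])⟩
  have hker (p : R × R) (hp : f p = 0) : p.1 ∈ 𝔪 ∧ p.2 ∈ 𝔪 := by
    have h : p.1 * a + p.2 * b = 0 := by simpa [f, a', b'] using congrArg Subtype.val hp
    constructor
    · by_contra hn
      exact (hV _ hn).2 ⟨-p.2, by linear_combination h⟩
    · by_contra hn
      exact (hV _ hn).1 ⟨-p.1, by linear_combination h⟩
  have lift (g : R × R →ₗ[R] R ⧸ 𝔪) (hg : LinearMap.ker f ≤ LinearMap.ker g) :
      ∃ φ : Ideal.span {a, b} →ₗ[R] R ⧸ 𝔪, ∀ p, φ (f p) = g p :=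
    ⟨(LinearMap.ker f).liftQ g hg ∘ₗ (f.quotKerEquivOfSurjective hf).symm.toLinearMap,
      fun p => by
        have : (f.quotKerEquivOfSurjective hf).symm (f p) = Submodule.Quotient.mk p := by
          rw [LinearEquiv.symm_apply_eq]
          rfl
        simp [this]⟩
  obtain ⟨φ, hφ⟩ := lift (𝔪.mkQ ∘ₗ LinearMap.fst R R R) fun p hp => by
    simpa [Ideal.Quotient.eq_zero_iff_mem] using (hker p hp).1
  obtain ⟨ψ, hψ⟩ := lift (𝔪.mkQ ∘ₗ LinearMap.snd R R R) fun p hp => by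
    simpa [Ideal.Quotient.eq_zero_iff_mem] using (hker p hp).2
  have hfa : f (1, 0) = a' := by simp [f]
  have hfb : f (0, 1) = b' := by simp [f]
  let t := a' ⊗ₜ[R] b' - b' ⊗ₜ[R] a'
  have ht : (a * b) • t = 0 := by
    have hab : b • a' = a • b' := Subtype.ext (mul_comm b a)
    have h₁ := TensorProduct.smul_tmul_smul b a a' b'
    have h₂ := TensorProduct.smul_tmul_smul a b b' a'
    rw [hab] at h₁ h₂
    rw [smul_sub, sub_eq_zero, ← h₂, h₁, mul_comm]
  have h₀ := H (algebraMap R _ (a * b)) (LocalizedModule.mkLinearMap _ _ t) <| by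
    rw [algebraMap_smul, ← map_smul, ht, map_zero]
  have hinj := IsLocalization.injective (Localization 𝔪.primeCompl)
    𝔪.primeCompl_le_nonZeroDivisors
  have h₁ := h₀.resolve_left fun h =>
    mul_ne_zero ha hb ((map_eq_zero_iff _ hinj).1 h)
  obtain ⟨s, hs : (s : R) • t = 0⟩ := (IsLocalizedModule.eq_zero_iff 𝔪.primeCompl _).1 h₁
  have h₂ := congrArg (LinearMap.mul' R (R ⧸ 𝔪) ∘ₗ TensorProduct.map φ ψ) hs
  have h₃ : (s : R) • (1 : R ⧸ 𝔪) = 0 := by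
    simpa [t, ← hfa, ← hfb, hφ, hψ] using h₂
  refine s.2 (Ideal.Quotient.eq_zero_iff_mem.1 ?_)
  rwa [Algebra.smul_def, mul_one] at h₃

end LocallyValuation

section PvMD

variable {R : Type*} [CommRing R] [IsDomain R] {K : Type*} [Field K] [Algebra R K]
  [IsFractionRing R K]

theorem IsPvMD.exists_dvd (h : IsPvMD R K) {𝔪 : Ideal R} (h𝔪 : IsMaximalWIdeal 𝔪) [𝔪.IsPrime]
    (a b : R) : ∃ u ∉ 𝔪, a ∣ u * b ∨ b ∣ u * a := by
  by_cases ha : a = 0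
  · exact ⟨1, 𝔪.one_notMem, .inr (by simp [ha])⟩
  have hI : Ideal.span {a, b} ≠ ⊥ := fun h₀ => ha (by
    have : a ∈ Ideal.span {a, b} := Ideal.subset_span (by simp)
    simpa [h₀] using this)
  obtain ⟨J, hJ, hle⟩ := h _ hI (Submodule.fg_span (by simp))
  by_contra! hV
  refine h𝔪.2.1.not_le h𝔪.1 hJ ((FractionalIdeal.coeIdeal_le_coeIdeal K).1 (hle.trans ?_))
  rw [FractionalIdeal.mul_le]
  rintro i hi c hc
  rw [FractionalIdeal.mem_inv_iff (FractionalIdeal.coeIdeal_ne_zero.2 hI)] at hc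
  have hmem (x : R) (hx : x ∈ Ideal.span {a, b}) :
      ∃ p : R, algebraMap R K p = c * algebraMap R K x :=
    (FractionalIdeal.mem_one_iff _).1 (hc _ (FractionalIdeal.mem_coeIdeal_of_mem _ hx))
  obtain ⟨p, hp⟩ := hmem a (Ideal.subset_span (by simp))
  obtain ⟨q, hq⟩ := hmem b (Ideal.subset_span (by simp))
  have hpq : p * b = a * q := IsFractionRing.injective R K (by
    rw [map_mul, map_mul, hp, hq]; ring)
  have hp' : p ∈ 𝔪 := by
    by_contra hn
    exact (hV p hn).1 ⟨q, hpq⟩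
  have hq' : q ∈ 𝔪 := by
    by_contra hn
    exact (hV q hn).2 ⟨p, by linear_combination -hpq⟩
  obtain ⟨i, hi', rfl⟩ := (FractionalIdeal.mem_coeIdeal _).1 hi
  obtain ⟨x, y, rfl⟩ := Ideal.mem_span_pair.1 hi'
  refine (FractionalIdeal.mem_coeIdeal _).2 ⟨x * p + y * q,
    𝔪.add_mem (𝔪.mul_mem_left _ hp') (𝔪.mul_mem_left _ hq'), ?_⟩
  simp only [map_add, map_mul, hp, hq]
  ring

theorem isPvMD_of_exists_dvd
    (hV : ∀ 𝔪 : Ideal R, IsMaximalWIdeal 𝔪 → 𝔪.IsPrime →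
      ∀ a b : R, ∃ u ∉ 𝔪, a ∣ u * b ∨ b ∣ u * a) : IsPvMD R K := by
  intro I hI hfg
  by_contra! hJ
  let T : FractionalIdeal (nonZeroDivisors R) K :=
    I * (I : FractionalIdeal (nonZeroDivisors R) K)⁻¹
  let A : Ideal R := (T : Submodule R K).comap (Algebra.linearMap R K)
  obtain ⟨P, hAP, hP, hprime⟩ := exists_le_isMaximalWIdeal (A := A) fun J hGV hle =>
    hJ J hGV fun x hx => by
      obtain ⟨y, hy, rfl⟩ := (FractionalIdeal.mem_coeIdeal _).1 hx
      exact hle hy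
  obtain ⟨a, ha, u, hu, hau⟩ := hfg.exists_smul_dvd (hV P hP hprime)
  have ha₀ : a ≠ 0 := by
    rintro rfl
    refine hI (eq_bot_iff.2 fun x hx => ?_)
    have := zero_dvd_iff.1 (hau x hx)
    exact (mul_eq_zero.1 this).resolve_left fun h => hu (h ▸ P.zero_mem)
  have ha₁ : algebraMap R K a ≠ 0 := by simpa using ha₀
  refine hu (hAP ?_)
  change algebraMap R K u ∈ T
  have : algebraMap R K u = algebraMap R K a * (algebraMap R K u / algebraMap R K a) := by
    field_simp
  rw [this]
  refine FractionalIdeal.mul_mem_mul (FractionalIdeal.mem_coeIdeal_of_mem _ ha) ?_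
  rw [FractionalIdeal.mem_inv_iff (FractionalIdeal.coeIdeal_ne_zero.2 hI)]
  intro y hy
  obtain ⟨x, hx, rfl⟩ := (FractionalIdeal.mem_coeIdeal _).1 hy
  obtain ⟨c, hc⟩ := hau x hx
  refine (FractionalIdeal.mem_one_iff _).2 ⟨c, ?_⟩
  rw [div_mul_eq_mul_div, eq_div_iff ha₁, ← map_mul, ← map_mul, hc, mul_comm]

end PvMD

/-- `R` is a PvMD iff for all torsion-free `R`-modules `M`, `N` and
every maximal `w`-ideal `𝔪` (which is prime), the localization `(M ⊗_R N)_𝔪` is a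
torsion-free module over `R_𝔪`. -/
theorem pvmd_iff_localized_tensor_torsionFree
    {R : Type u} [CommRing R] [IsDomain R] :
    IsPvMD R (FractionRing R) ↔
      ∀ (M N : Type u) [AddCommGroup M] [Module R M] [AddCommGroup N] [Module R N],
        (∀ (r : R) (m : M), r • m = 0 → r = 0 ∨ m = 0) →
        (∀ (r : R) (n : N), r • n = 0 → r = 0 ∨ n = 0) →
        ∀ (𝔪 : Ideal R), IsMaximalWIdeal 𝔪 → ∀ (hp : 𝔪.IsPrime),
          haveI := hp
          ∀ (r : Localization 𝔪.primeCompl)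
            (x : LocalizedModule 𝔪.primeCompl (M ⊗[R] N)),
            r • x = 0 → r = 0 ∨ x = 0 := by
  constructor
  · intro h M N _ _ _ _ hM hN 𝔪 h𝔪 hp
    have := Module.IsTorsionFree.of_smul_eq_zero hM
    have := Module.IsTorsionFree.of_smul_eq_zero hN
    have := hp
    have := IsLocalization.isDomain_localization 𝔪.primeCompl_le_nonZeroDivisors
    have := valuationRing_localization_of_dvd (h.exists_dvd h𝔪)
    exact tensor_localizedModule_torsionFree _
  · intro H
    refine isPvMD_of_exists_dvd fun 𝔪 h𝔪 hp a b => ?_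
    by_cases ha : a = 0
    · exact ⟨1, 𝔪.one_notMem, .inr (by simp [ha])⟩
    by_cases hb : b = 0
    · exact ⟨1, 𝔪.one_notMem, .inl (by simp [hb])⟩
    have htf (r : R) (x : Ideal.span {a, b}) (h : r • x = 0) : r = 0 ∨ x = 0 := by
      simpa using h
    exact exists_dvd_of_tensor_torsionFree ha hb (H _ _ htf htf 𝔪 h𝔪 hp)
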